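/- arXiv:0912.2829 — 2 statements merged into one kernel-verified Lean document; each statement's English description precedes it below -/
import Mathlib

section
/- The 𝔽_p-dimension of the quotient V_{pe₁s−s}/V_{pe₁s−s+1} equals f, the residual degree of F over ℚ_p. -/
/-- The subgroup of `p`-th powers in `Kˣ`. -/
noncomputable def pthPowers (p : ℕ) (K : Type*) [Field K] : Subgroup Kˣ :=
  (powMonoidHom p : Kˣ →* Kˣ).range

/-- The `𝔽_p`-vector space `Kˣ/(Kˣ)ᵖ`. -/
abbrev KmodP (p : ℕ) (K : Type*) [Field K] :=
  Kˣ ⧸ pthPowers p K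

/-- For `i ≥ 1`, the image `Ū_i` of `U_i = 1 + 𝔓^i` in `Kˣ/(Kˣ)ᵖ`, where `𝔓` is the
maximal ideal of the ring of integers of `K` and `w` is the normalized valuation. -/
def UbarSet (p : ℕ) (K : Type*) [Field K] (w : K → ℤ) (i : ℤ) : Set (KmodP p K) :=
  {c | ∃ x : Kˣ, (QuotientGroup.mk x : KmodP p K) = c ∧
    ∃ u y : K, y ≠ 0 ∧ (u - 1 = 0 ∨ i ≤ w (u - 1)) ∧ (x : K) = u * y ^ p}

/-- The `ω`-eigenspace `V ⊆ Kˣ/(Kˣ)ᵖ` for the natural action of `Δ = Gal(K|F)`: the set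
of classes `x̄` with `σ(x)·x^{−ω(σ)} ∈ (Kˣ)ᵖ` for all `σ ∈ Δ`. -/
def omegaEigenspace (p : ℕ) (F K : Type*) [Field F] [Field K] [Algebra F K]
    (ω : (K ≃ₐ[F] K) → (ZMod p)ˣ) : Set (KmodP p K) :=
  {c | ∃ x : Kˣ, (QuotientGroup.mk x : KmodP p K) = c ∧
    ∀ σ : K ≃ₐ[F] K, ∃ y : K, y ≠ 0 ∧ σ (x : K) = (x : K) ^ (ω σ : ZMod p).val * y ^ p}

/-- `w` is an (additively written) integer-valued valuation on the nonzero elements of `K`. -/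
structure IsIntValuation {K : Type*} [Field K] (w : K → ℤ) : Prop where
  map_mul : ∀ x y : K, x ≠ 0 → y ≠ 0 → w (x * y) = w x + w y
  le_map_add : ∀ x y : K, x ≠ 0 → y ≠ 0 → x + y ≠ 0 → min (w x) (w y) ≤ w (x + y)

/-- `x` has valuation at least `i`, with the convention that `0` has infinite valuation. -/
def ValGE {K : Type*} [Field K] (w : K → ℤ) (i : ℤ) (x : K) : Prop :=
  x = 0 ∨ i ≤ w x

namespace IsIntValuation

variable {K : Type*} [Field K] {w : K → ℤ} (hw : IsIntValuation w)
include hw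

theorem map_one : w 1 = 0 := by
  have := hw.map_mul 1 1 one_ne_zero one_ne_zero
  rw [mul_one] at this
  linarith

theorem map_neg (x : K) : w (-x) = w x := by
  by_cases hx : x = 0
  · simp [hx]
  have h1 : (-1 : K) ≠ 0 := by simp
  have h := hw.map_mul (-1) (-1) h1 h1
  have h2 := hw.map_mul (-1) x h1 hx
  rw [neg_mul_neg, mul_one, hw.map_one] at h
  rw [neg_one_mul] at h2
  linarith

theorem map_inv {x : K} (hx : x ≠ 0) : w x⁻¹ = -w x := by
  have := hw.map_mul x x⁻¹ hx (inv_ne_zero hx)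
  rw [mul_inv_cancel₀ hx, hw.map_one] at this
  linarith

theorem map_pow {x : K} (hx : x ≠ 0) (n : ℕ) : w (x ^ n) = n * w x := by
  induction n with
  | zero => simp [hw.map_one]
  | succ n ih =>
    rw [pow_succ, hw.map_mul _ _ (pow_ne_zero n hx) hx, ih]
    push_cast
    ring

theorem map_zpow {x : K} (hx : x ≠ 0) (n : ℤ) : w (x ^ n) = n * w x := by
  obtain ⟨n, rfl | rfl⟩ := n.eq_nat_or_neg
  · simpa using hw.map_pow hx n
  · rw [zpow_neg, hw.map_inv (by simp [hx])]
    have := hw.map_pow hx n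
    simp [this]

theorem add {i : ℤ} {x y : K} (hx : ValGE w i x) (hy : ValGE w i y) : ValGE w i (x + y) := by
  by_cases h : x + y = 0
  · exact Or.inl h
  rcases hx with rfl | hx
  · simpa using hy
  rcases hy with rfl | hy'
  · simpa [ValGE] using Or.inr hx
  by_cases hx0 : x = 0
  · subst hx0; exact Or.inr (by simpa using hy')
  by_cases hy0 : y = 0
  · subst hy0; exact Or.inr (by simpa using hx)
  exact Or.inr ((le_min hx hy').trans (hw.le_map_add x y hx0 hy0 h))

theorem neg {i : ℤ} {x : K} (hx : ValGE w i x) : ValGE w i (-x) := by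
  unfold ValGE
  rw [hw.map_neg, neg_eq_zero]
  exact hx

theorem sub {i : ℤ} {x y : K} (hx : ValGE w i x) (hy : ValGE w i y) : ValGE w i (x - y) := by
  rw [sub_eq_add_neg]
  exact hw.add hx (hw.neg hy)

theorem mul {i j : ℤ} {x y : K} (hx : ValGE w i x) (hy : ValGE w j y) :
    ValGE w (i + j) (x * y) := by
  by_cases hx0 : x = 0
  · exact Or.inl (by simp [hx0])
  by_cases hy0 : y = 0
  · exact Or.inl (by simp [hy0])
  refine Or.inr ?_
  rw [hw.map_mul x y hx0 hy0]
  exact add_le_add (hx.resolve_left hx0) (hy.resolve_left hy0)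

omit hw in
theorem mono {i j : ℤ} {x : K} (hx : ValGE w i x) (h : j ≤ i) : ValGE w j x :=
  hx.imp_right h.trans

theorem one : ValGE w 0 (1 : K) := Or.inr hw.map_one.ge

/-- The valuation ring of `w`. -/
def ring : Subring K where
  carrier := {x | ValGE w 0 x}
  mul_mem' hx hy := by simpa using hw.mul hx hy
  one_mem' := hw.one
  add_mem' hx hy := hw.add hx hy
  zero_mem' := Or.inl rfl
  neg_mem' hx := hw.neg hx

theorem mem_ring {x : K} : x ∈ hw.ring ↔ ValGE w 0 x := Iff.rfl

theorem mul_left {i : ℤ} {x y : K} (hx : ValGE w 0 x) (hy : ValGE w i y) :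
    ValGE w i (x * y) := by simpa using hw.mul hx hy

theorem natCast (n : ℕ) : ValGE w 0 (n : K) := natCast_mem hw.ring n

theorem sum {ι : Type*} (s : Finset ι) (f : ι → K) {i : ℤ} (h : ∀ j ∈ s, ValGE w i (f j)) :
    ValGE w i (∑ j ∈ s, f j) := by
  classical
  induction s using Finset.induction_on with
  | empty => exact Or.inl (by simp)
  | insert a s ha ih =>
    rw [Finset.sum_insert ha]
    exact hw.add (h a (by simp)) (ih fun j hj => h j (by simp [hj]))

theorem of_mul {i : ℤ} {x y : K} (hy0 : y ≠ 0) (hxy : ValGE w (i + w y) (x * y)) :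
    ValGE w i x := by
  by_cases hx0 : x = 0
  · exact Or.inl hx0
  have := hxy.resolve_left (mul_ne_zero hx0 hy0)
  rw [hw.map_mul x y hx0 hy0] at this
  exact Or.inr (by linarith)

theorem eq_zero_of_sub_one {x : K} (hx : ValGE w 1 (x - 1)) : x ≠ 0 ∧ w x = 0 := by
  have hx0 : x ≠ 0 := by
    rintro rfl
    rcases hx with h | h
    · simp at h
    · rw [zero_sub, hw.map_neg, hw.map_one] at h
      omega
  have h0 : 0 ≤ w x := by
    have := hw.add (mono hx zero_le_one) hw.one
    rw [sub_add_cancel] at this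
    exact this.resolve_left hx0
  refine ⟨hx0, le_antisymm ?_ h0⟩
  by_contra! h
  have := (hw.sub (Or.inr h : ValGE w 1 x) hx).resolve_left (by simp)
  rw [sub_sub_cancel, hw.map_one] at this
  omega

theorem comap {F : Type*} [Field F] (φ : F →+* K) : IsIntValuation (fun x => w (φ x)) where
  map_mul x y hx hy := by
    rw [_root_.map_mul]
    exact hw.map_mul _ _ (by simpa using hx) (by simpa using hy)
  le_map_add x y hx hy hxy := by
    rw [_root_.map_add]
    exact hw.le_map_add _ _ (by simpa using hx) (by simpa using hy)
      (by rw [← _root_.map_add]; exact (map_ne_zero φ).2 hxy)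

theorem div {i : ℤ} {x y : K} (hy0 : y ≠ 0) (hx : ValGE w (i + w y) x) :
    ValGE w i (x / y) :=
  hw.of_mul hy0 (by rwa [div_mul_cancel₀ _ hy0])

/-- The absolute value attached to `w` and a base `B > 1`. -/
noncomputable def absoluteValue {B : ℝ} (hB : 1 < B) : AbsoluteValue K ℝ := by
  classical
  exact
  { toFun := fun x => if x = 0 then 0 else B ^ (-w x)
    map_mul' := fun x y => by
      by_cases hx : x = 0
      · simp [hx]
      by_cases hy : y = 0
      · simp [hy]
      simp only [hx, hy, mul_eq_zero, or_self, if_false]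
      rw [hw.map_mul x y hx hy, neg_add, zpow_add₀ (by positivity)]
    nonneg' := fun x => by
      split_ifs <;> positivity
    eq_zero' := fun x => by
      have : ∀ n : ℤ, B ^ n ≠ 0 := fun n => by positivity
      simp [this]
    add_le' := fun x y => by
      by_cases hx : x = 0
      · simp [hx]
      by_cases hy : y = 0
      · simp [hy]
      rw [if_neg hx, if_neg hy]
      have hx' : 0 < B ^ (-w x) := by positivity
      have hy' : 0 < B ^ (-w y) := by positivity
      split_ifs with h
      · positivity
      have := hw.le_map_add x y hx hy h
      rcases min_le_iff.1 this with h | h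
      · have := zpow_le_zpow_right₀ hB.le (neg_le_neg h)
        linarith
      · have := zpow_le_zpow_right₀ hB.le (neg_le_neg h)
        linarith }

theorem absoluteValue_apply {B : ℝ} (hB : 1 < B) {x : K} (hx : x ≠ 0) :
    hw.absoluteValue hB x = B ^ (-w x) := by
  classical
  exact if_neg hx

end IsIntValuation

section Padic

variable {p : ℕ} [hp : Fact p.Prime]

theorem PadicInt.exists_pow_eq_one_add_mul (y : ℤ_[p]) {N : ℕ} (hN : ¬ p ∣ N) :
    ∃ z : ℤ_[p], z ^ N = 1 + p * y := by
  have hN' : ‖(N : ℤ_[p])‖ = 1 := by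
    have := (PadicInt.norm_int_lt_one_iff_dvd (p := p) (N : ℤ)).not.2 (by exact_mod_cast hN)
    push_cast at this
    exact le_antisymm (PadicInt.norm_le_one _) (not_lt.1 this)
  have hlt : ‖(p : ℤ_[p]) * y‖ < 1 := by
    rw [norm_mul]
    have h1 := PadicInt.norm_le_one y
    have h2 : ‖(p : ℤ_[p])‖ < 1 := by
      simpa using inv_lt_one_of_one_lt₀ (by exact_mod_cast hp.out.one_lt : (1 : ℝ) < p)
    nlinarith [norm_nonneg y, norm_nonneg (p : ℤ_[p])]
  obtain ⟨z, hz, -⟩ := hensels_lemma (p := p)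
    (F := (Polynomial.X ^ N - Polynomial.C (1 + p * y) : Polynomial ℤ_[p])) (a := 1) (by
      simpa [Polynomial.derivative_X_pow, hN'] using hlt)
  refine ⟨z, ?_⟩
  simpa [sub_eq_zero] using hz

namespace IsIntValuation

theorem map_one_add_p_mul {w : ℚ_[p] → ℤ} (hw : IsIntValuation w) (y : ℤ_[p])
    (h0 : (1 + p * y : ℚ_[p]) ≠ 0) : w (1 + p * y) = 0 := by
  by_contra h
  set N := p * (w (1 + p * y)).natAbs + 1 with hN
  obtain ⟨z, hz⟩ := PadicInt.exists_pow_eq_one_add_mul y (N := N) (by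
    rw [hN, Nat.dvd_add_right (dvd_mul_right _ _)]
    exact hp.out.one_lt.ne' ∘ Nat.dvd_one.1)
  have hz' : (z : ℚ_[p]) ^ N = 1 + p * y := by exact_mod_cast congrArg ((↑) : ℤ_[p] → ℚ_[p]) hz
  have hz0 : (z : ℚ_[p]) ≠ 0 := by
    rintro h
    rw [h, zero_pow (by omega)] at hz'
    exact h0 hz'.symm
  have hdvd : (N : ℤ) ∣ w (1 + p * y) := by
    rw [← hz', hw.map_pow hz0]
    exact dvd_mul_right _ _
  have := Nat.le_of_dvd (Int.natAbs_pos.2 h) (Int.natCast_dvd.1 hdvd)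
  have := Nat.le_mul_of_pos_left (w (1 + p * y)).natAbs hp.out.pos
  omega

theorem padicInt_valGE {w : ℚ_[p] → ℤ} (hw : IsIntValuation w) (hp0 : 0 < w p) (x : ℤ_[p]) :
    ValGE w 0 (x : ℚ_[p]) := by
  by_cases hx0 : (x : ℚ_[p]) = 0
  · exact Or.inl hx0
  by_contra hx
  have hneg : w (x : ℚ_[p]) < 0 := not_le.1 fun h => hx (Or.inr h)
  have hpne : (p : ℚ_[p]) ≠ 0 := by exact_mod_cast hp.out.ne_zero
  set n := (w p).toNat + 1 with hn
  have hn' : (n : ℤ) = w p + 1 := by omega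
  have hval : w (p * (x : ℚ_[p]) ^ n) < 0 := by
    rw [hw.map_mul _ _ hpne (pow_ne_zero _ hx0), hw.map_pow hx0, hn']
    nlinarith
  by_cases h0 : (1 + p * ((x ^ n : ℤ_[p]) : ℚ_[p]) : ℚ_[p]) = 0
  · have : (p * (x : ℚ_[p]) ^ n : ℚ_[p]) = -1 := by
      push_cast at h0
      linear_combination h0
    rw [this, hw.map_neg, hw.map_one] at hval
    exact lt_irrefl _ hval
  have h1 := hw.map_one_add_p_mul (x ^ n) h0
  have h2 := hw.sub (Or.inr h1.ge : ValGE w 0 _) hw.one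
  rw [add_sub_cancel_left] at h2
  push_cast at h2
  have := h2.resolve_left (mul_ne_zero hpne (pow_ne_zero _ hx0))
  omega

theorem map_padic {w : ℚ_[p] → ℤ} (hw : IsIntValuation w) (hp0 : 0 < w p) {x : ℚ_[p]}
    (hx : x ≠ 0) : w x = x.valuation * w p := by
  have hpne : (p : ℚ_[p]) ≠ 0 := by exact_mod_cast hp.out.ne_zero
  have hunit : ∀ u : ℚ_[p], ‖u‖ = 1 → w u = 0 := by
    intro u hu
    have hu0 : u ≠ 0 := by rintro rfl; simp at hu
    have h1 := (hw.padicInt_valGE hp0 ⟨u, hu.le⟩).resolve_left hu0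
    have h2 := (hw.padicInt_valGE hp0 ⟨u⁻¹, by simp [hu]⟩).resolve_left (inv_ne_zero hu0)
    change 0 ≤ w u⁻¹ at h2
    change 0 ≤ w u at h1
    rw [hw.map_inv hu0] at h2
    omega
  have hz : (p : ℚ_[p]) ^ x.valuation ≠ 0 := zpow_ne_zero _ hpne
  have h := hunit (x / (p : ℚ_[p]) ^ x.valuation) (by
    rw [norm_div, Padic.norm_eq_zpow_neg_valuation hx, Padic.norm_p_zpow,
      div_self (zpow_ne_zero _ (by exact_mod_cast hp.out.ne_zero))])
  have h2 := hw.map_mul _ _ (div_ne_zero hx hz) hz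
  rwa [div_mul_cancel₀ _ hz, h, hw.map_zpow hpne, zero_add] at h2

/-- A valuation on an algebraic extension of `ℚ_[p]` with `w p > 0` induces the spectral norm. -/
theorem exists_spectralNorm_eq {L : Type*} [Field L] [Algebra ℚ_[p] L] [Algebra.IsAlgebraic ℚ_[p] L]
    {w : L → ℤ} (hw : IsIntValuation w) (hp0 : 0 < w p) :
    ∃ B : ℝ, 1 < B ∧ ∀ x : L, x ≠ 0 → spectralNorm ℚ_[p] L x = B ^ (-w x) := by
  have hp1 : (1 : ℝ) < p := by exact_mod_cast hp.out.one_lt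
  have hpR : (0 : ℝ) < w p := by exact_mod_cast hp0
  set B : ℝ := (p : ℝ) ^ ((w p : ℝ)⁻¹) with hBdef
  have hB : 1 < B := Real.one_lt_rpow hp1 (inv_pos.2 hpR)
  have hBp : B ^ (w p) = p := by
    rw [hBdef, ← Real.rpow_intCast, ← Real.rpow_mul (by positivity), inv_mul_cancel₀ hpR.ne',
      Real.rpow_one]
  refine ⟨B, hB, fun x hx => ?_⟩
  rw [← hw.absoluteValue_apply hB hx]
  refine (spectralNorm_unique_field_norm_ext (fun k => ?_) x).symm
  by_cases hk : k = 0
  · simp [hk]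
  rw [hw.absoluteValue_apply hB (by simpa using hk), Padic.norm_eq_zpow_neg_valuation hk]
  have := (hw.comap (algebraMap ℚ_[p] L)).map_padic (by simpa using hp0) hk
  simp only [map_natCast] at this
  rw [this, ← hBp, ← zpow_mul]
  congr 1
  ring

theorem map_algEquiv {L : Type*} [Field L] [Algebra ℚ_[p] L] [Algebra.IsAlgebraic ℚ_[p] L]
    {w : L → ℤ} (hw : IsIntValuation w) (hp0 : 0 < w p) (σ : L ≃ₐ[ℚ_[p]] L) (x : L) :
    w (σ x) = w x := by
  by_cases hx : x = 0
  · simp [hx]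
  obtain ⟨B, hB, h⟩ := hw.exists_spectralNorm_eq hp0
  have h1 := spectralNorm_eq_of_equiv σ x
  rw [h x hx, h (σ x) (by simpa using hx)] at h1
  have := (zpow_right_injective₀ (by positivity) hB.ne') h1
  omega

theorem mem_integralClosure_padicInt_iff {L : Type*} [Field L] [Algebra ℚ_[p] L]
    [Algebra.IsAlgebraic ℚ_[p] L] [Algebra ℤ_[p] L] [IsScalarTower ℤ_[p] ℚ_[p] L]
    {w : L → ℤ} (hw : IsIntValuation w) (hp0 : 0 < w p) (x : L) :
    x ∈ integralClosure ℤ_[p] L ↔ ValGE w 0 x := by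
  by_cases hx : x = 0
  · subst hx
    exact ⟨fun _ => Or.inl rfl, fun _ => zero_mem _⟩
  obtain ⟨B, hB, h⟩ := hw.exists_spectralNorm_eq hp0
  have hint : IsIntegral ℚ_[p] x := Algebra.IsIntegral.isIntegral x
  have h1 : ValGE w 0 x ↔ spectralNorm ℚ_[p] L x ≤ 1 := by
    rw [h x hx, zpow_le_one_iff_right₀ hB]
    simp [ValGE, hx]
  rw [h1, spectralNorm, spectralValue_le_one_iff (minpoly.monic hint), mem_integralClosure_iff]
  constructor
  · intro hx n
    rw [minpoly.isIntegrallyClosed_eq_field_fractions' ℚ_[p] hx, Polynomial.coeff_map]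
    exact PadicInt.norm_le_one _
  · intro hn
    obtain ⟨q, hq, -, hqm⟩ := Polynomial.lifts_and_natDegree_eq_and_monic
      (f := algebraMap ℤ_[p] ℚ_[p]) (p := minpoly ℚ_[p] x)
      ((Polynomial.lifts_iff_coeff_lifts _).2 fun n => ⟨⟨_, hn n⟩, rfl⟩) (minpoly.monic hint)
    refine ⟨q, hqm, ?_⟩
    have : Polynomial.aeval x (q.map (algebraMap ℤ_[p] ℚ_[p])) = 0 := by
      rw [hq, minpoly.aeval]
    rwa [Polynomial.aeval_map_algebraMap] at this

end IsIntValuation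

end Padic

section ResidueField

open Module

theorem IsLocalRing.natCard_quotient_map (R S : Type*) [CommRing R] [CommRing S] [Algebra R S]
    [IsLocalRing R] [Module.Finite R S] [Module.Free R S] :
    Nat.card (S ⧸ Ideal.map (algebraMap R S) (IsLocalRing.maximalIdeal R)) =
      Nat.card (R ⧸ IsLocalRing.maximalIdeal R) ^ finrank R S := by
  rw [Nat.card_congr (basisQuotient (Module.Free.chooseBasis R S)).equivFun.toEquiv, Nat.card_fun,
    Nat.card_eq_fintype_card (α := Module.Free.ChooseBasisIndex R S),
    finrank_eq_card_chooseBasisIndex]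

variable {p : ℕ} [hp : Fact p.Prime]

/-- The valuation ring of a finite extension `L` of `ℚ_[p]` with absolute ramification index `e`
has residue field of cardinality `p ^ f`, where `e * f` is the degree of `L`. -/
theorem IsIntValuation.exists_card_quotient_eq {L : Type*} [Field L] [Algebra ℚ_[p] L]
    [FiniteDimensional ℚ_[p] L] {v : L → ℤ} (hv : IsIntValuation v) {s : ℕ} (hs : 0 < s)
    (hdvd : ∀ z : L, z ≠ 0 → (s : ℤ) ∣ v z) {z : L} (hz0 : z ≠ 0) (hz : v z = s)
    {e f : ℕ} (he : 0 < e) (hvp : v p = (e * s : ℕ)) (hef : e * f = finrank ℚ_[p] L) :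
    ∃ (R : Subring L) (P : Ideal R), (∀ x, x ∈ R ↔ ValGE v 0 x) ∧
      (∀ x : R, x ∈ P ↔ ValGE v 1 (x : L)) ∧ Nat.card (R ⧸ P) = p ^ f := by
  let : Algebra ℤ_[p] L := ((algebraMap ℚ_[p] L).comp (algebraMap ℤ_[p] ℚ_[p])).toAlgebra
  have : IsScalarTower ℤ_[p] ℚ_[p] L := IsScalarTower.of_algebraMap_eq fun _ => rfl
  have hvp0 : 0 < v p := by rw [hvp]; positivity
  have hmem := hv.mem_integralClosure_padicInt_iff hvp0
  set S := integralClosure ℤ_[p] L with hS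
  have hded : IsDedekindDomain S := integralClosure.isDedekindDomain ℤ_[p] (K := ℚ_[p]) (L := L)
  have hfin : Module.Finite ℤ_[p] S := IsIntegralClosure.finite ℤ_[p] ℚ_[p] L S
  have : IsTorsionFree ℤ_[p] L := by
    rw [isTorsionFree_iff_algebraMap_injective]
    exact (algebraMap ℚ_[p] L).injective.comp Subtype.coe_injective
  have hfree : Module.Free ℤ_[p] S := IsIntegralClosure.module_free ℤ_[p] ℚ_[p] L S
  have hrank : finrank ℤ_[p] S = finrank ℚ_[p] L := IsIntegralClosure.rank ℤ_[p] ℚ_[p] L S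
  let π : S := ⟨z, (hmem z).2 (Or.inr (by rw [hz]; positivity))⟩
  have hP : ∀ x : S, x ∈ Ideal.span {π} ↔ ValGE v 1 (x : L) := by
    intro x
    rw [Ideal.mem_span_singleton']
    constructor
    · rintro ⟨a, rfl⟩
      exact IsIntValuation.mono (hv.mul_left ((hmem _).1 a.2) (Or.inr hz.ge)) (by omega)
    · intro hx
      refine ⟨⟨x / z, (hmem _).2 (hv.div hz0 ?_)⟩, Subtype.ext (div_mul_cancel₀ _ hz0)⟩
      rw [hz, zero_add]
      refine (em ((x : L) = 0)).imp id fun hx0 => ?_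
      exact Int.le_of_dvd (by have := hx.resolve_left hx0; omega) (hdvd _ hx0)
  have hprime : (Ideal.span {π}).IsPrime := by
    refine ⟨?_, ?_⟩
    · rw [Ne, Ideal.eq_top_iff_one, hP]
      simp [ValGE, hv.map_one]
    · intro x y hxy
      simp only [hP] at hxy ⊢
      by_contra! h
      have hx0 : (x : L) ≠ 0 := fun h0 => h.1 (Or.inl h0)
      have hy0 : (y : L) ≠ 0 := fun h0 => h.2 (Or.inl h0)
      have := hxy.resolve_left (mul_ne_zero hx0 hy0)
      have hx : v x < 1 := not_le.1 fun h0 => h.1 (Or.inr h0)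
      have hy : v y < 1 := not_le.1 fun h0 => h.2 (Or.inr h0)
      rw [show ((x * y : S) : L) = x * y from rfl, hv.map_mul _ _ hx0 hy0] at this
      omega
  have hbot : Ideal.span {π} ≠ ⊥ := by
    rw [Ne, Ideal.span_singleton_eq_bot]
    exact fun h => hz0 (congrArg Subtype.val h)
  have hpz : Ideal.map (algebraMap ℤ_[p] S) (IsLocalRing.maximalIdeal ℤ_[p]) =
      Ideal.span {π} ^ e := by
    have hpL : (p : L) ≠ 0 := by
      rintro h
      rw [h] at hvp0
      have h2 := (map_natCast (algebraMap ℚ_[p] L) p).trans h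
      rw [map_eq_zero] at h2
      exact hp.out.ne_zero (by exact_mod_cast h2)
    have hze : z ^ e ≠ 0 := pow_ne_zero _ hz0
    have hvze : v (z ^ e) = v p := by rw [hv.map_pow hz0, hz, hvp]; push_cast; rfl
    rw [PadicInt.maximalIdeal_eq_span_p, Ideal.map_span, Set.image_singleton, map_natCast,
      Ideal.span_singleton_pow, Ideal.span_singleton_eq_span_singleton]
    refine associated_of_dvd_dvd
      ⟨⟨z ^ e / p, (hmem _).2 (hv.div hpL (Or.inr (by simp [hvze])))⟩, Subtype.ext ?_⟩
      ⟨⟨p / z ^ e, (hmem _).2 (hv.div hze (Or.inr (by simp [hvze])))⟩, Subtype.ext ?_⟩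
    · exact (mul_div_cancel₀ _ hpL).symm
    · exact (mul_div_cancel₀ _ hze).symm
  have hcard : Nat.card (S ⧸ Ideal.map (algebraMap ℤ_[p] S) (IsLocalRing.maximalIdeal ℤ_[p])) =
      p ^ (e * f) := by
    rw [IsLocalRing.natCard_quotient_map, hrank, hef,
      show Nat.card (ℤ_[p] ⧸ IsLocalRing.maximalIdeal ℤ_[p]) = p from
        (Nat.card_congr (PadicInt.residueField (p := p)).toEquiv).trans (Nat.card_zmod p)]
  refine ⟨S.toSubring, Ideal.span {π}, hmem, hP, ?_⟩
  rw [hpz] at hcard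
  have hpow := cardQuot_pow_of_prime (P := Ideal.span {π}) hbot (i := e)
  rw [Submodule.cardQuot_apply, Submodule.cardQuot_apply] at hpow
  have h3 : Nat.card (S ⧸ Ideal.span {π}) ^ e = (p ^ f) ^ e := by
    rw [← hpow, ← pow_mul, mul_comm f e]
    exact hcard
  exact Nat.pow_left_injective he.ne' h3

end ResidueField

section PrimitiveRoot

variable {p : ℕ} [hp : Fact p.Prime] {K : Type*} [Field K] {w : K → ℤ}

namespace IsIntValuation

variable (hw : IsIntValuation w)
include hw

theorem map_primitiveRoot {ζ : K} (hζ : IsPrimitiveRoot ζ p) : w ζ = 0 := by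
  have h := hw.map_pow (hζ.ne_zero hp.out.ne_zero) p
  rw [hζ.pow_eq_one, hw.map_one] at h
  exact (mul_eq_zero.1 h.symm).resolve_left (by exact_mod_cast hp.out.ne_zero)

theorem valGE_primitiveRoot {ζ : K} (hζ : IsPrimitiveRoot ζ p) : ValGE w 0 ζ :=
  Or.inr (hw.map_primitiveRoot hζ).ge

theorem map_primitiveRoot_sub_one_le {ζ μ : K} (hζ : IsPrimitiveRoot ζ p)
    (hμ : IsPrimitiveRoot μ p) : w (ζ - 1) ≤ w (μ - 1) := by
  have hμ1 : μ - 1 ≠ 0 := sub_ne_zero.2 (hμ.ne_one hp.out.one_lt)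
  obtain ⟨j, -, rfl⟩ := hζ.eq_pow_of_pow_eq_one hμ.pow_eq_one
  have hsum : ValGE w 0 (∑ i ∈ Finset.range j, ζ ^ i) :=
    Subring.sum_mem hw.ring
      fun i _ => pow_mem (hw.mem_ring.2 (hw.valGE_primitiveRoot hζ)) i
  have h := hw.mul_left hsum (Or.inr le_rfl : ValGE w (w (ζ - 1)) (ζ - 1))
  rw [geom_sum_mul] at h
  exact h.resolve_left hμ1

theorem mul_map_primitiveRoot_sub_one {ζ : K} (hζ : IsPrimitiveRoot ζ p) :
    ((p - 1 : ℕ) : ℤ) * w (ζ - 1) = w p := by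
  have h1 : ∀ μ ∈ primitiveRoots p K, (1 - μ ≠ 0) ∧ w (1 - μ) = w (ζ - 1) := by
    intro μ hμ
    have hμ' := (mem_primitiveRoots hp.out.pos).1 hμ
    refine ⟨sub_ne_zero.2 (hμ'.ne_one hp.out.one_lt).symm, ?_⟩
    rw [← neg_sub, hw.map_neg]
    exact le_antisymm (hw.map_primitiveRoot_sub_one_le hμ' hζ)
      (hw.map_primitiveRoot_sub_one_le hζ hμ')
  have h2 : ∀ T : Finset K, (∀ μ ∈ T, (1 - μ ≠ 0) ∧ w (1 - μ) = w (ζ - 1)) →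
      w (∏ μ ∈ T, (1 - μ)) = T.card * w (ζ - 1) := by
    classical
    intro T
    induction T using Finset.induction_on with
    | empty => simp [hw.map_one]
    | insert a T ha ih =>
      intro h
      have hT : ∀ μ ∈ T, (1 - μ ≠ 0) ∧ w (1 - μ) = w (ζ - 1) := fun μ hμ => h μ (by simp [hμ])
      rw [Finset.prod_insert ha, hw.map_mul _ _ (h a (by simp)).1
        (Finset.prod_ne_zero_iff.2 fun μ hμ => (hT μ hμ).1), ih hT, (h a (by simp)).2,
        Finset.card_insert_of_notMem ha]
      push_cast
      ring
  have h3 : ∏ μ ∈ primitiveRoots p K, (1 - μ) = p := by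
    have := Polynomial.eval_one_cyclotomic_prime (R := K) (p := p)
    rw [Polynomial.cyclotomic_eq_prod_X_sub_primitiveRoots hζ, Polynomial.eval_prod] at this
    simpa using this
  rw [← h3, h2 _ h1, hζ.card_primitiveRoots, Nat.totient_prime hp.out]

/-- A `p`-th power in `1 + 𝔓 ^ i` with `p ∤ i` and `i < p * w (ζ - 1)` lies in
`1 + 𝔓 ^ (i + 1)`. -/
theorem pow_sub_one_valGE_succ {c : ℤ} (hc : (p - 1 : ℤ) * c = w p) (hp0 : (p : K) ≠ 0)
    {i : ℤ} (hi : 0 < i) (hpi : ¬ (p : ℤ) ∣ i) (hic : i < p * c) {y : K} (hy0 : y ≠ 0)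
    (hy : ValGE w i (y ^ p - 1)) : ValGE w (i + 1) (y ^ p - 1) := by
  have hppos : (0 : ℤ) < p := by exact_mod_cast hp.out.pos
  have hp1 : (0 : ℤ) < p - 1 := by have := hp.out.one_lt; omega
  have hwy : w y = 0 := by
    have h := (hw.eq_zero_of_sub_one (mono hy hi)).2
    rw [hw.map_pow hy0] at h
    exact (mul_eq_zero.1 h).resolve_left hppos.ne'
  by_cases hd0 : y - 1 = 0
  · rw [sub_eq_zero.1 hd0]
    exact Or.inl (by simp)
  obtain ⟨⟨r, hr⟩, h⟩ := exists_add_pow_prime_eq hp.out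
    (⟨y - 1, hw.sub (Or.inr hwy.ge) hw.one⟩ : hw.ring) 1
  have hexp : y ^ p - 1 = (y - 1) ^ p + p * (y - 1) * r := by
    have := congrArg Subtype.val h
    simp only [Subring.coe_pow, Subring.coe_add, Subring.coe_mul, Subring.coe_one,
      sub_add_cancel, one_pow, mul_one, Subring.coe_natCast] at this
    rw [this]
    ring
  have hd := (hw.sub (Or.inr hwy.ge : ValGE w 0 y) hw.one).resolve_left hd0
  have hc0 : 0 < c := by nlinarith
  have hwp : 0 < w p := by rw [← hc]; positivity
  have hlin : ValGE w (w p + w (y - 1)) (p * (y - 1) * r) := by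
    simpa using hw.mul (Or.inr (hw.map_mul _ _ hp0 hd0).ge) hr
  have hpow : w ((y - 1) ^ p) = p * w (y - 1) := hw.map_pow hd0 p
  have hpow0 : (y - 1) ^ p ≠ 0 := pow_ne_zero _ hd0
  have hpowge : ValGE w (p * w (y - 1)) ((y - 1) ^ p) := Or.inr hpow.ge
  have hpowexp : (y - 1) ^ p = (y ^ p - 1) - p * (y - 1) * r := by rw [hexp]; ring
  rw [hexp]
  rcases lt_or_ge (p * w (y - 1)) i with hlt | hge
  · exfalso
    have hdc : w (y - 1) < c := by nlinarith
    have h2 : ValGE w (p * w (y - 1) + 1) ((y - 1) ^ p) := by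
      rw [hpowexp]
      exact hw.sub (mono hy hlt) (mono hlin (by nlinarith))
    have := h2.resolve_left hpow0
    omega
  · have hne : p * w (y - 1) ≠ i := fun h => hpi ⟨_, h.symm⟩
    have hgt : i + 1 ≤ p * w (y - 1) := by omega
    refine hw.add (mono hpowge hgt) (mono hlin ?_)
    rcases lt_or_ge (w (y - 1)) c with hdc | hdc
    · nlinarith
    · nlinarith

theorem natCast_sub_natCast (hp0 : 0 < w p) {m n : ℕ} (h : (m : ZMod p) = n) :
    ValGE w 1 (m - n : K) := by
  have h' : ((m - n : ℤ) : ZMod p) = 0 := by push_cast; rw [h, sub_self]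
  obtain ⟨k, hk⟩ := (ZMod.intCast_zmod_eq_zero_iff_dvd _ p).1 h'
  have h2 : (m - n : K) = k * p := by
    have := congrArg ((↑) : ℤ → K) hk
    push_cast at this
    rw [this, mul_comm]
  rw [h2]
  exact hw.mul_left (intCast_mem hw.ring k) (Or.inr hp0)

theorem map_natCast_eq_zero (hp0 : 0 < w p) {m : ℕ} (hm : (m : ZMod p) ≠ 0) :
    (m : K) ≠ 0 ∧ w m = 0 := by
  have h1 := hw.natCast_sub_natCast hp0 (m := m * (m : ZMod p)⁻¹.val) (n := 1)
    (by push_cast; rw [ZMod.natCast_zmod_val, mul_inv_cancel₀ hm])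
  rw [Nat.cast_one] at h1
  obtain ⟨h0, h2⟩ := hw.eq_zero_of_sub_one h1
  push_cast at h0 h2
  have hm0 := left_ne_zero_of_mul h0
  have hk0 := right_ne_zero_of_mul h0
  rw [hw.map_mul _ _ hm0 hk0] at h2
  have h3 := (hw.natCast m).resolve_left hm0
  have h4 := (hw.natCast _).resolve_left hk0
  exact ⟨hm0, by omega⟩

theorem exists_pow_sub_one_pow_eq (hp0 : 0 < w p) {ζ : K} (hζ : IsPrimitiveRoot ζ p) (m : ℕ)
    (hζ1 : ValGE w 1 (ζ - 1)) :
    ∃ Q : K, ValGE w 1 (Q - m) ∧ (ζ ^ m - 1) ^ p = Q * (ζ - 1) ^ p := by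
  set q := ∑ i ∈ Finset.range m, ζ ^ i with hq
  have hζ0 := hw.valGE_primitiveRoot hζ
  have hqm : ValGE w 1 (q - m) := by
    have : q - m = ∑ i ∈ Finset.range m, (ζ ^ i - 1) := by simp [hq]
    rw [this]
    refine hw.sum _ _ fun i _ => ?_
    rw [← geom_sum_mul]
    exact hw.mul_left (Subring.sum_mem hw.ring fun j _ => pow_mem
      (hw.mem_ring.2 hζ0) j) hζ1
  refine ⟨q ^ p, ?_, by rw [← mul_pow, geom_sum_mul]⟩
  have hq0 : ValGE w 0 q := by simpa using hw.add (mono hqm zero_le_one) (hw.natCast m)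
  have h1 : ValGE w 1 (q ^ p - (m : K) ^ p) := by
    rw [← (Commute.all q (m : K)).geom_sum₂_mul]
    exact hw.mul_left (Subring.sum_mem hw.ring fun j _ =>
      mul_mem (pow_mem (hw.mem_ring.2 hq0) _) (pow_mem (natCast_mem hw.ring m) _)) hqm
  have h2 := hw.natCast_sub_natCast hp0 (m := m ^ p) (n := m) (by push_cast; exact ZMod.pow_card _)
  push_cast at h2
  simpa using hw.add h1 h2

end IsIntValuation

end PrimitiveRoot

section FirstOrder

variable {K : Type*} [Field K] {w : K → ℤ} {t : K}

/-- The integral element `a` is a first-order coefficient of `x` with respect to `t`: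
`x ≡ 1 + a t` modulo elements of valuation greater than `w t`. -/
def FirstOrder (w : K → ℤ) (t x a : K) : Prop :=
  ValGE w 0 a ∧ ValGE w (w t + 1) (x - (1 + a * t))

namespace FirstOrder

theorem one (a : K) (ha : ValGE w 0 a) :
    FirstOrder w t (1 + a * t) a :=
  ⟨ha, Or.inl (sub_self _)⟩

theorem sub_one_valGE (hw : IsIntValuation w) {x a : K} (h : FirstOrder w t x a) :
    ValGE w (w t) (x - 1) := by
  have := hw.add (IsIntValuation.mono h.2 (by omega : w t ≤ w t + 1))
    (hw.mul_left h.1 (Or.inr le_rfl : ValGE w (w t) t))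
  convert this using 1
  ring

theorem ne_zero (hw : IsIntValuation w) (ht : 1 ≤ w t) {x a : K} (h : FirstOrder w t x a) :
    x ≠ 0 :=
  (hw.eq_zero_of_sub_one (IsIntValuation.mono (h.sub_one_valGE hw) ht)).1

theorem map_eq_zero (hw : IsIntValuation w) (ht : 1 ≤ w t) {x a : K} (h : FirstOrder w t x a) :
    w x = 0 :=
  (hw.eq_zero_of_sub_one (IsIntValuation.mono (h.sub_one_valGE hw) ht)).2

theorem mul (hw : IsIntValuation w) (ht : 1 ≤ w t) {x y a b : K} (hx : FirstOrder w t x a)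
    (hy : FirstOrder w t y b) : FirstOrder w t (x * y) (a + b) := by
  refine ⟨hw.add hx.1 hy.1, ?_⟩
  have hy0 : ValGE w 0 y := Or.inr (hy.map_eq_zero hw ht).ge
  have hat := hw.mul_left hx.1 (Or.inr le_rfl : ValGE w (w t) t)
  have hbt := hw.mul_left hy.1 (Or.inr le_rfl : ValGE w (w t) t)
  have h1 := hw.mul_left hy0 hx.2
  have h3 := IsIntValuation.mono (hw.mul hat hbt) (by omega : w t + 1 ≤ w t + w t)
  have h2 := hw.mul_left (hw.add hw.one (IsIntValuation.mono hat (by omega))) hy.2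
  convert hw.add (hw.add h1 h2) h3 using 1
  ring

theorem inv (hw : IsIntValuation w) (ht : 1 ≤ w t) {x a : K} (hx : FirstOrder w t x a) :
    FirstOrder w t x⁻¹ (-a) := by
  refine ⟨hw.neg hx.1, ?_⟩
  have hx0 := hx.ne_zero hw ht
  have hat := hw.mul_left hx.1 (Or.inr le_rfl : ValGE w (w t) t)
  have hinv : ValGE w 0 x⁻¹ := Or.inr (by rw [hw.map_inv hx0, hx.map_eq_zero hw ht, neg_zero])
  have h3 := IsIntValuation.mono (hw.mul hat (hx.sub_one_valGE hw)) (by omega : w t + 1 ≤ w t + w t)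
  convert hw.mul_left hinv (hw.sub h3 hx.2) using 1
  field_simp
  ring

theorem pow (hw : IsIntValuation w) (ht : 1 ≤ w t) {x a : K} (hx : FirstOrder w t x a) (n : ℕ) :
    FirstOrder w t (x ^ n) (n * a) := by
  induction n with
  | zero => simpa using one (t := t) 0 (Or.inl rfl)
  | succ n ih =>
    rw [pow_succ, Nat.cast_succ, add_mul, one_mul]
    exact ih.mul hw ht hx

theorem prod (hw : IsIntValuation w) (ht : 1 ≤ w t) {ι : Type*} (s : Finset ι) {x a : ι → K}
    (h : ∀ i ∈ s, FirstOrder w t (x i) (a i)) :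
    FirstOrder w t (∏ i ∈ s, x i) (∑ i ∈ s, a i) := by
  classical
  induction s using Finset.induction_on with
  | empty => simpa using one (t := t) 0 (Or.inl rfl)
  | insert i s hi ih =>
    rw [Finset.prod_insert hi, Finset.sum_insert hi]
    exact (h i (by simp)).mul hw ht (ih fun j hj => h j (by simp [hj]))

theorem congr (hw : IsIntValuation w) {x a b : K} (hx : FirstOrder w t x a)
    (hab : ValGE w 1 (a - b)) : FirstOrder w t x b := by
  refine ⟨?_, ?_⟩
  · simpa using hw.sub hx.1 (IsIntValuation.mono hab zero_le_one)
  · have h := hw.mul hab (Or.inr le_rfl : ValGE w (w t) t)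
    rw [add_comm] at h
    convert hw.add hx.2 h using 1
    ring

theorem sub_valGE (hw : IsIntValuation w) (ht0 : t ≠ 0) {x a : K} (hx : FirstOrder w t x a)
    (h : ValGE w (w t + 1) (x - 1)) : ValGE w 1 a := by
  refine hw.of_mul ht0 ?_
  rw [add_comm]
  convert hw.sub h hx.2 using 1
  ring

theorem of_sub_one (hw : IsIntValuation w) (ht0 : t ≠ 0) {x : K} (h : ValGE w (w t) (x - 1)) :
    FirstOrder w t x ((x - 1) / t) := by
  refine ⟨hw.div ht0 (by rwa [zero_add]), ?_⟩
  rw [div_mul_cancel₀ _ ht0]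
  exact Or.inl (by ring)

theorem map (hw : IsIntValuation w) (σ : K →+* K) (hσ : ∀ x, w (σ x) = w x) {m x a : K}
    (hm : ValGE w 0 m) (hσt : ValGE w (w t + 1) (σ t - m * t)) (hx : FirstOrder w t x a) :
    FirstOrder w t (σ x) (m * σ a) := by
  have hmap : ∀ {i : ℤ} {y : K}, ValGE w i y → ValGE w i (σ y) := fun {i y} hy =>
    hy.imp (fun h => by rw [h, map_zero]) fun h => by rwa [hσ]
  refine ⟨hw.mul_left hm (hmap hx.1), ?_⟩
  convert hw.add (hmap hx.2) (hw.mul_left (hmap hx.1) hσt) using 1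
  rw [map_sub, map_add, map_mul, map_one]
  ring

end FirstOrder

end FirstOrder

section Eigenspace

open IsIntValuation

variable {p : ℕ} [hp : Fact p.Prime] {F K : Type*} [Field F] [Field K] [Algebra F K]
  {w : K → ℤ} {t : K} {m : (K ≃ₐ[F] K) → ℕ}

variable (hw : IsIntValuation w) (hp0 : 0 < w p) (ht : 1 ≤ w t)
  (hσ : ∀ (σ : K ≃ₐ[F] K) x, w (σ x) = w x)
  (hσt : ∀ σ : K ≃ₐ[F] K, ValGE w (w t + 1) (σ t - m σ * t))
  (hm0 : ∀ σ, (m σ : ZMod p) ≠ 0)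
  (hpow : ∀ y : K, y ≠ 0 → ValGE w (w t) (y ^ p - 1) → ValGE w (w t + 1) (y ^ p - 1))
  [Fintype (K ≃ₐ[F] K)] (hcard : (Fintype.card (K ≃ₐ[F] K) : ZMod p) ≠ 0)

include hw hp0 ht hσ hσt hm0 hcard in
theorem exists_eigenvector_firstOrder (hmul : ∀ σ τ, (m (σ * τ) : ZMod p) = m σ * m τ) {a : K}
    (ha : ValGE w 0 a) (hfix : ∀ σ : K ≃ₐ[F] K, σ a = a) :
    ∃ x : K, FirstOrder w t x a ∧ ∀ σ : K ≃ₐ[F] K, ∃ y : K, y ≠ 0 ∧ σ x = x ^ m σ * y ^ p := by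
  obtain ⟨hd0, hwd⟩ := hw.map_natCast_eq_zero hp0 hcard
  set d : ℕ := Fintype.card (K ≃ₐ[F] K) with hd
  set b : K := a / d with hb
  have hb0 : ValGE w 0 b := hw.div hd0 (by rwa [hwd, zero_add])
  have hbfix : ∀ σ : K ≃ₐ[F] K, σ b = b := fun σ => by rw [hb, map_div₀, hfix, map_natCast]
  set u : K := 1 + b * t with hu
  have hσu : ∀ σ : K ≃ₐ[F] K, FirstOrder w t (σ u) (m σ * b) := fun σ => by
    have := FirstOrder.map hw (σ : K →+* K) (hσ σ) (hw.natCast (m σ)) (hσt σ)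
      (FirstOrder.one (t := t) b hb0)
    rwa [RingHom.coe_coe, hbfix] at this
  have hm1 : (m 1 : ZMod p) = 1 := by
    have := hmul 1 1
    rw [mul_one] at this
    exact (mul_eq_left₀ (hm0 1)).1 this.symm
  have hfac : ∀ σ : K ≃ₐ[F] K, FirstOrder w t (σ u ^ m σ⁻¹) b := fun σ => by
    refine ((hσu σ).pow hw ht (m σ⁻¹)).congr hw ?_
    have h := hw.natCast_sub_natCast hp0 (m := m σ⁻¹ * m σ) (n := 1) (by
      push_cast
      rw [← hmul, inv_mul_cancel, hm1])
    convert hw.mul_left hb0 h using 1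
    push_cast
    ring
  refine ⟨∏ σ : K ≃ₐ[F] K, σ u ^ m σ⁻¹, ?_, fun τ => ?_⟩
  · have h := FirstOrder.prod hw ht Finset.univ fun σ _ => hfac σ
    rwa [Finset.sum_const, Finset.card_univ, nsmul_eq_mul, mul_div_cancel₀ _ hd0] at h
  · have hex : ∀ σ : K ≃ₐ[F] K, ∃ y : K, y ≠ 0 ∧
        σ u ^ m (σ⁻¹ * τ) = (σ u ^ m σ⁻¹) ^ m τ * y ^ p := by
      intro σ
      have hne := (hσu σ).ne_zero hw ht
      have h : ((m (σ⁻¹ * τ) - m σ⁻¹ * m τ : ℤ) : ZMod p) = 0 := by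
        push_cast
        rw [hmul, sub_self]
      obtain ⟨k, hk⟩ := (ZMod.intCast_zmod_eq_zero_iff_dvd _ p).1 h
      refine ⟨σ u ^ k, zpow_ne_zero _ hne, ?_⟩
      rw [← pow_mul, ← zpow_natCast, ← zpow_natCast, ← zpow_natCast, ← zpow_mul, ← zpow_add₀ hne]
      congr 1
      push_cast
      linarith
    choose y hy0 hy using hex
    refine ⟨∏ σ, y σ, Finset.prod_ne_zero_iff.2 fun σ _ => hy0 σ, ?_⟩
    rw [map_prod, ← Finset.prod_pow, ← Finset.prod_pow, ← Finset.prod_mul_distrib,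
      ← Finset.prod_congr rfl fun σ _ => hy σ]
    refine Fintype.prod_equiv (Equiv.mulLeft τ) _ _ fun σ => ?_
    simp [mul_inv_rev]

include hw hp0 ht hσ hσt hm0 hcard hpow in
theorem exists_fixed_firstOrder {x : K} (hx : ValGE w (w t) (x - 1)) (ht0 : t ≠ 0)
    (hV : ∀ σ : K ≃ₐ[F] K, ∃ y : K, y ≠ 0 ∧ σ x = x ^ m σ * y ^ p) :
    ∃ a : K, (∀ σ : K ≃ₐ[F] K, σ a = a) ∧ FirstOrder w t x a := by
  obtain ⟨hd0, hwd⟩ := hw.map_natCast_eq_zero hp0 hcard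
  set d : ℕ := Fintype.card (K ≃ₐ[F] K) with hd
  have hxb := FirstOrder.of_sub_one hw ht0 hx
  set b := (x - 1) / t with hb
  have hx0 := hxb.ne_zero hw ht
  have hσb : ∀ σ : K ≃ₐ[F] K, ValGE w 1 (σ b - b) := by
    intro σ
    obtain ⟨y, hy0, hy⟩ := hV σ
    obtain ⟨hmK, hwm⟩ := hw.map_natCast_eq_zero hp0 (hm0 σ)
    have h1 := FirstOrder.map hw (σ : K →+* K) (hσ σ) (hw.natCast (m σ)) (hσt σ) hxb
    have h2 := h1.mul hw ht ((hxb.pow hw ht (m σ)).inv hw ht)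
    have h3 : (σ : K →+* K) x * (x ^ m σ)⁻¹ = y ^ p := by
      rw [RingHom.coe_coe, hy]
      field_simp
    rw [h3] at h2
    have h4 := h2.sub_valGE hw ht0 (hpow y hy0 (h2.sub_one_valGE hw))
    refine hw.of_mul hmK ?_
    rw [hwm, add_zero]
    convert h4 using 1
    rw [RingHom.coe_coe]
    ring
  refine ⟨(∑ σ : K ≃ₐ[F] K, σ b) / d, fun τ => ?_, hxb.congr hw ?_⟩
  · rw [map_div₀, map_sum, map_natCast]
    congr 1
    exact Fintype.sum_equiv (Equiv.mulLeft τ) _ _ fun σ => rfl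
  · have h : b - (∑ σ : K ≃ₐ[F] K, σ b) / d = -((∑ σ : K ≃ₐ[F] K, (σ b - b)) / d) := by
      rw [Finset.sum_sub_distrib, Finset.sum_const, Finset.card_univ, nsmul_eq_mul]
      field_simp
      ring
    rw [h]
    refine hw.neg (hw.div hd0 ?_)
    rw [hwd, add_zero]
    exact hw.sum _ _ fun σ _ => hσb σ

end Eigenspace

section KmodP

variable {p : ℕ} {K : Type*} [Field K]

theorem mk_eq_mk_iff_exists_pow {x x' : Kˣ} :
    (QuotientGroup.mk x : KmodP p K) = QuotientGroup.mk x' ↔ ∃ y : Kˣ, x' = x * y ^ p := by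
  rw [QuotientGroup.eq]
  exact exists_congr fun y => ⟨fun h => eq_mul_of_inv_mul_eq h.symm,
    fun h => (inv_mul_eq_of_eq_mul h).symm⟩

theorem mk_mem_UbarSet_iff {w : K → ℤ} {i : ℤ} {x : Kˣ} :
    (QuotientGroup.mk x : KmodP p K) ∈ UbarSet p K w i ↔
      ∃ u y : K, y ≠ 0 ∧ ValGE w i (u - 1) ∧ (x : K) = u * y ^ p := by
  constructor
  · rintro ⟨x', hx', u, y, hy0, hu, h⟩
    obtain ⟨z, rfl⟩ := mk_eq_mk_iff_exists_pow.1 hx'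
    refine ⟨u, y * z, mul_ne_zero hy0 z.ne_zero, hu, ?_⟩
    rw [Units.val_mul, h, Units.val_pow_eq_pow_val]
    ring
  · exact fun h => ⟨x, rfl, h⟩

theorem mk_mem_omegaEigenspace_iff {F : Type*} [Field F] [Algebra F K]
    {ω : (K ≃ₐ[F] K) → (ZMod p)ˣ} {x : Kˣ} :
    (QuotientGroup.mk x : KmodP p K) ∈ omegaEigenspace p F K ω ↔
      ∀ σ : K ≃ₐ[F] K, ∃ y : K, y ≠ 0 ∧ σ (x : K) = (x : K) ^ (ω σ : ZMod p).val * y ^ p := by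
  constructor
  · rintro ⟨x', hx', h⟩ σ
    obtain ⟨z, rfl⟩ := mk_eq_mk_iff_exists_pow.1 hx'
    obtain ⟨y, hy0, hy⟩ := h σ
    refine ⟨y * σ z * ((z : K) ^ (ω σ : ZMod p).val)⁻¹, by simp [hy0], ?_⟩
    rw [Units.val_mul, map_mul, hy, Units.val_pow_eq_pow_val, map_pow, mul_pow, mul_pow, mul_pow,
      inv_pow, ← pow_mul, ← pow_mul, mul_comm p]
    have := z.ne_zero
    field_simp
  · exact fun h => ⟨x, rfl, h⟩

/-- The `ω`-eigenspace as a subgroup of `Kˣ/(Kˣ)ᵖ`. -/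
def omegaEigenspaceSubgroup (p : ℕ) (F K : Type*) [Field F] [Field K] [Algebra F K]
    (ω : (K ≃ₐ[F] K) → (ZMod p)ˣ) : Subgroup (KmodP p K) where
  carrier := omegaEigenspace p F K ω
  one_mem' := mk_mem_omegaEigenspace_iff.2 fun _ => ⟨1, one_ne_zero, by simp⟩
  mul_mem' := by
    rintro ⟨x⟩ ⟨x'⟩ hx hx'
    refine mk_mem_omegaEigenspace_iff.2 fun σ => ?_
    obtain ⟨y, hy0, hy⟩ := mk_mem_omegaEigenspace_iff.1 hx σ
    obtain ⟨y', hy0', hy'⟩ := mk_mem_omegaEigenspace_iff.1 hx' σ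
    refine ⟨y * y', mul_ne_zero hy0 hy0', ?_⟩
    rw [Units.val_mul, map_mul, hy, hy']
    ring
  inv_mem' := by
    rintro ⟨x⟩ hx
    refine mk_mem_omegaEigenspace_iff.2 fun σ => ?_
    obtain ⟨y, hy0, hy⟩ := mk_mem_omegaEigenspace_iff.1 hx σ
    refine ⟨y⁻¹, inv_ne_zero hy0, ?_⟩
    rw [Units.val_inv_eq_inv_val, map_inv₀, hy, mul_inv, inv_pow, inv_pow]

/-- The image of `1 + 𝔓 ^ i`, for `i ≥ 1`, as a subgroup of `Kˣ/(Kˣ)ᵖ`. -/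
def UbarSubgroup (p : ℕ) {w : K → ℤ} (hw : IsIntValuation w) {i : ℤ} (hi : 1 ≤ i) :
    Subgroup (KmodP p K) where
  carrier := UbarSet p K w i
  one_mem' := mk_mem_UbarSet_iff.2 ⟨1, 1, one_ne_zero, Or.inl (sub_self _), by simp⟩
  mul_mem' := by
    rintro ⟨x⟩ ⟨x'⟩ hx hx'
    obtain ⟨u, y, hy0, hu, h⟩ := mk_mem_UbarSet_iff.1 hx
    obtain ⟨u', y', hy0', hu', h'⟩ := mk_mem_UbarSet_iff.1 hx'
    refine mk_mem_UbarSet_iff.2 ⟨u * u', y * y', mul_ne_zero hy0 hy0', ?_, ?_⟩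
    · have hu0 := hw.eq_zero_of_sub_one (IsIntValuation.mono hu hi)
      convert hw.add (hw.mul_left (Or.inr hu0.2.ge) hu') hu using 1
      ring
    · rw [Units.val_mul, h, h']
      ring
  inv_mem' := by
    rintro ⟨x⟩ hx
    obtain ⟨u, y, hy0, hu, h⟩ := mk_mem_UbarSet_iff.1 hx
    have hu0 := hw.eq_zero_of_sub_one (IsIntValuation.mono hu hi)
    refine mk_mem_UbarSet_iff.2 ⟨u⁻¹, y⁻¹, inv_ne_zero hy0, ?_, ?_⟩
    · convert hw.neg (hw.div hu0.1 (by rwa [hu0.2, add_zero] : ValGE w (i + w u) (u - 1))) using 1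
      have := hu0.1
      field_simp
      ring
    · rw [Units.val_inv_eq_inv_val, h, mul_inv, inv_pow]

theorem mk_inv_mul_mk_mem_UbarSet_iff {w : K → ℤ} (hw : IsIntValuation w) {t : K} (ht0 : t ≠ 0)
    (ht : 1 ≤ w t)
    (hpow : ∀ y : K, y ≠ 0 → ValGE w (w t) (y ^ p - 1) → ValGE w (w t + 1) (y ^ p - 1))
    {x y : Kˣ} {a b : K} (hx : FirstOrder w t x a) (hy : FirstOrder w t y b) :
    (QuotientGroup.mk x : KmodP p K)⁻¹ * QuotientGroup.mk y ∈ UbarSet p K w (w t + 1) ↔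
      ValGE w 1 (a - b) := by
  have hxy : FirstOrder w t ((x⁻¹ * y : Kˣ) : K) (-a + b) := by
    rw [Units.val_mul, Units.val_inv_eq_inv_val]
    exact (hx.inv hw ht).mul hw ht hy
  rw [← QuotientGroup.mk_inv, ← QuotientGroup.mk_mul, mk_mem_UbarSet_iff]
  constructor
  · rintro ⟨u, z, hz0, hu, h⟩
    have hu1 : FirstOrder w t u 0 := ⟨Or.inl rfl, by simpa using hu⟩
    have hu0 := hu1.ne_zero hw ht
    have hz := hxy.mul hw ht (hu1.inv hw ht)
    rw [h, mul_assoc, mul_comm, mul_assoc, inv_mul_cancel₀ hu0, mul_one] at hz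
    have := hw.neg (hz.sub_valGE hw ht0 (hpow z hz0 (hz.sub_one_valGE hw)))
    convert this using 1
    ring
  · intro h
    refine ⟨_, 1, one_ne_zero, ?_, by rw [one_pow, mul_one]⟩
    have h0 : FirstOrder w t ((x⁻¹ * y : Kˣ) : K) 0 := hxy.congr hw (by
      convert hw.neg h using 1
      ring)
    simpa using h0.2

theorem Subgroup.index_eq_natCard_quotient {R G : Type*} [CommRing R] [Group G] (P : Ideal R)
    (H : Subgroup G) (g : R → G) (hg : ∀ a b, (g a)⁻¹ * g b ∈ H ↔ a - b ∈ P)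
    (hsurj : ∀ α : G, ∃ a, (g a)⁻¹ * α ∈ H) : H.index = Nat.card (R ⧸ P) := by
  have hmk : ∀ a b, (QuotientGroup.mk (g a) : G ⧸ H) = QuotientGroup.mk (g b) ↔
      Ideal.Quotient.mk P a = Ideal.Quotient.mk P b := fun a b => by
    rw [QuotientGroup.eq, hg, Ideal.Quotient.eq]
  have hout : ∀ q : R ⧸ P, Ideal.Quotient.mk P q.out = q := Quotient.out_eq
  refine (Nat.card_congr (Equiv.ofBijective
    (fun q : R ⧸ P => (QuotientGroup.mk (g q.out) : G ⧸ H)) ⟨fun q q' h => ?_, ?_⟩)).symm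
  · rw [← hout q, ← hout q']
    exact (hmk _ _).1 h
  · rintro ⟨α⟩
    obtain ⟨a, ha⟩ := hsurj α
    exact ⟨Ideal.Quotient.mk P a, ((hmk _ _).2 (hout _)).trans (QuotientGroup.eq.2 ha)⟩

/-- A transversal of `B` in `A` parametrized by the classes modulo an ideal counts `A / B`. -/
theorem Subgroup.natCard_eq_natCard_quotient_mul {R G : Type*} [CommRing R] [Group G]
    (P : Ideal R) {A B : Subgroup G} (hBA : B ≤ A) (g : R → G) (hgA : ∀ a, g a ∈ A)
    (hg : ∀ a b, (g a)⁻¹ * g b ∈ B ↔ a - b ∈ P)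
    (hsurj : ∀ α ∈ A, ∃ a, (g a)⁻¹ * α ∈ B) : Nat.card A = Nat.card (R ⧸ P) * Nat.card B := by
  rw [← (B.subgroupOf A).card_mul_index, Nat.card_congr (Subgroup.subgroupOfEquivOfLe hBA).toEquiv,
    Subgroup.index_eq_natCard_quotient P (B.subgroupOf A) (fun a => ⟨g a, hgA a⟩) hg
      fun α => hsurj α α.2, mul_comm]

end KmodP

section Cyclotomic

variable {p : ℕ} [hp : Fact p.Prime] {F K : Type*} [Field F] [Field K] [Algebra F K] {ζ : K}

theorem IsPrimitiveRoot.algebraAdjoin_eq_top (hζ : IsPrimitiveRoot ζ p)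
    (h : IntermediateField.adjoin F {ζ} = ⊤) : Algebra.adjoin F {ζ} = ⊤ := by
  have hint : IsIntegral F ζ := (hζ.isIntegral hp.out.pos).tower_top
  rw [← IntermediateField.adjoin_simple_toSubalgebra_of_isAlgebraic hint.isAlgebraic, h,
    IntermediateField.top_toSubalgebra]

theorem IsPrimitiveRoot.isCyclotomicExtension_of_adjoin_eq_top (hζ : IsPrimitiveRoot ζ p)
    (h : IntermediateField.adjoin F {ζ} = ⊤) : IsCyclotomicExtension {p} F K := by
  refine (IsCyclotomicExtension.iff_singleton p F K).2 ⟨⟨ζ, hζ⟩, fun x => ?_⟩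
  have hx : x ∈ Algebra.adjoin F {ζ} := hζ.algebraAdjoin_eq_top h ▸ Algebra.mem_top
  exact Algebra.adjoin_mono (by simpa using hζ.pow_eq_one) hx

theorem IsPrimitiveRoot.cyclotomicCharacter_mul (hζ : IsPrimitiveRoot ζ p)
    {ω : (K ≃ₐ[F] K) → (ZMod p)ˣ}
    (hω : ∀ σ : K ≃ₐ[F] K, σ ζ = ζ ^ (ω σ : ZMod p).val) (σ τ : K ≃ₐ[F] K) :
    ω (σ * τ) = ω σ * ω τ := by
  have h : ζ ^ (ω (σ * τ) : ZMod p).val = ζ ^ ((ω σ : ZMod p).val * (ω τ : ZMod p).val) := by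
    rw [← hω, AlgEquiv.mul_apply, hω τ, map_pow, hω σ, pow_mul]
  rw [(hζ.isOfFinOrder hp.out.ne_zero).pow_inj_mod, ← hζ.eq_orderOf,
    ← ZMod.natCast_eq_natCast_iff'] at h
  ext
  push_cast at h
  simpa [ZMod.natCast_zmod_val] using h

theorem IsPrimitiveRoot.cyclotomicCharacter_injective (hζ : IsPrimitiveRoot ζ p)
    (h : IntermediateField.adjoin F {ζ} = ⊤) {ω : (K ≃ₐ[F] K) → (ZMod p)ˣ}
    (hω : ∀ σ : K ≃ₐ[F] K, σ ζ = ζ ^ (ω σ : ZMod p).val) : Function.Injective ω := by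
  intro σ τ hστ
  have h1 : σ ζ = τ ζ := by rw [hω, hω, hστ]
  have h2 : (σ : K →ₐ[F] K) = τ :=
    AlgHom.ext_of_adjoin_eq_top (hζ.algebraAdjoin_eq_top h) (by simpa using h1)
  exact AlgEquiv.coe_toAlgHom_injective h2

end Cyclotomic

section Galois

variable {p : ℕ} [hp : Fact p.Prime] {F K : Type*} [Field F] [Field K] [Algebra F K] {w : K → ℤ}

/-- The values of `w` on the fixed field are multiples of `s`, so `s` divides the order of the
Galois group. -/
theorem IsIntValuation.dvd_card_of_isGalois [FiniteDimensional F K] [IsGalois F K]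
    (hw : IsIntValuation w) (hσ : ∀ (σ : K ≃ₐ[F] K) (x : K), w (σ x) = w x)
    {π : K} (hπ0 : π ≠ 0) (hπ : w π = 1) {s : ℕ}
    (hsdvd : ∀ z : F, z ≠ 0 → (s : ℤ) ∣ w (algebraMap F K z)) :
    s ∣ Fintype.card (K ≃ₐ[F] K) := by
  have hprod : ∀ S : Finset (K ≃ₐ[F] K), ∏ σ ∈ S, σ π ≠ 0 ∧ w (∏ σ ∈ S, σ π) = S.card := by
    classical
    intro S
    induction S using Finset.induction_on with
    | empty => simp [hw.map_one]
    | insert σ S hS ih =>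
      have h0 : σ π ≠ 0 := (map_ne_zero σ).2 hπ0
      rw [Finset.prod_insert hS, Finset.card_insert_of_notMem hS, hw.map_mul _ _ h0 ih.1, hσ, hπ,
        ih.2]
      exact ⟨mul_ne_zero h0 ih.1, by push_cast; ring⟩
  have hnorm : algebraMap F K (Algebra.norm F π) = ∏ σ : K ≃ₐ[F] K, σ π :=
    Algebra.norm_eq_prod_automorphisms F π
  have h := hsdvd (Algebra.norm F π) (Algebra.norm_ne_zero_iff.2 hπ0)
  rw [hnorm, (hprod Finset.univ).2] at h
  exact_mod_cast h

theorem card_lt_of_injective_units [Fintype (K ≃ₐ[F] K)] {ω : (K ≃ₐ[F] K) → (ZMod p)ˣ}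
    (hω : Function.Injective ω) : Fintype.card (K ≃ₐ[F] K) < p := by
  have h := Fintype.card_le_of_injective ω hω
  rw [ZMod.card_units p] at h
  have := hp.out.one_lt
  omega

end Galois

/-- The `𝔽_p`-dimension of `V_{pe₁s−s}/V_{pe₁s−s+1}` equals `f`, the residual degree of
`F|ℚ_p` (equivalently, since these are elementary abelian `p`-groups,
`Card V_{pe₁s−s} = p^f · Card V_{pe₁s−s+1}`), where `V_i = V ∩ Ū_i`. -/
theorem statement8 (p : ℕ) [hp : Fact p.Prime] (hodd : Odd p)
    (F : Type*) [Field F] [Algebra ℚ_[p] F] [FiniteDimensional ℚ_[p] F]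
    (hreg : ¬ ∃ z : F, IsPrimitiveRoot z p)
    (K : Type*) [Field K] [Algebra F K]
    (ζ : K) (hζ : IsPrimitiveRoot ζ p)
    (hKgen : IntermediateField.adjoin F {ζ} = ⊤)
    (ω : (K ≃ₐ[F] K) → (ZMod p)ˣ)
    (hω : ∀ σ : K ≃ₐ[F] K, σ ζ = ζ ^ (ω σ : ZMod p).val)
    (w : K → ℤ) (hw0 : w 0 = 0)
    (hwmul : ∀ x y : K, x ≠ 0 → y ≠ 0 → w (x * y) = w x + w y)
    (hwadd : ∀ x y : K, x ≠ 0 → y ≠ 0 → x + y ≠ 0 → min (w x) (w y) ≤ w (x + y))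
    (hwsurj : ∃ π : K, π ≠ 0 ∧ w π = 1)
    (s : ℕ) (hs : 0 < s)
    (hsdvd : ∀ z : F, z ≠ 0 → (s : ℤ) ∣ w (algebraMap F K z))
    (hsval : ∃ z : F, z ≠ 0 ∧ w (algebraMap F K z) = (s : ℤ))
    (e : ℕ) (he : 0 < e) (hew : w (algebraMap F K (p : F)) = (e * s : ℕ))
    (f : ℕ) (hf : 0 < f) (hef : e * f = Module.finrank ℚ_[p] F)
    (e1s : ℕ) (he1s : (p - 1) * e1s = e * s)
    :
    Nat.card ↥(omegaEigenspace p F K ω ∩ UbarSet p K w (((p * e1s : ℕ) : ℤ) - s)) =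
      p ^ f *
        Nat.card ↥(omegaEigenspace p F K ω ∩ UbarSet p K w (((p * e1s : ℕ) : ℤ) - s + 1)) := by
  have hw : IsIntValuation w := ⟨hwmul, hwadd⟩
  have hK := hζ.isCyclotomicExtension_of_adjoin_eq_top hKgen
  have := IsCyclotomicExtension.finiteDimensional {p} F K
  have := IsCyclotomicExtension.isGalois {p} F K
  let : Algebra ℚ_[p] K := ((algebraMap F K).comp (algebraMap ℚ_[p] F)).toAlgebra
  have : IsScalarTower ℚ_[p] F K := IsScalarTower.of_algebraMap_eq fun _ => rfl
  have : FiniteDimensional ℚ_[p] K := FiniteDimensional.trans ℚ_[p] F K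
  have : CharZero K := charZero_of_injective_algebraMap (algebraMap ℚ_[p] K).injective
  have hpK : (p : K) ≠ 0 := Nat.cast_ne_zero.2 hp.out.ne_zero
  have hwp : w p = (e * s : ℕ) := by rw [← hew, map_natCast]
  have hp0 : 0 < w p := by rw [hwp]; exact_mod_cast Nat.mul_pos he hs
  have hσ (σ : K ≃ₐ[F] K) (x : K) : w (σ x) = w x :=
    hw.map_algEquiv hp0 (σ.restrictScalars ℚ_[p]) x
  have hζ0 : ζ - 1 ≠ 0 := sub_ne_zero.2 (hζ.ne_one hp.out.one_lt)
  have hc : w (ζ - 1) = e1s := by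
    have h := hw.mul_map_primitiveRoot_sub_one hζ
    rw [hwp, ← he1s, Nat.cast_mul] at h
    exact mul_left_cancel₀ (by have := hp.out.one_lt; norm_cast; omega) h
  have he1s0 : 0 < e1s := Nat.pos_of_mul_pos_left (he1s ▸ Nat.mul_pos he hs)
  have hζ1 : ValGE w 1 (ζ - 1) := Or.inr (by rw [hc]; exact_mod_cast he1s0)
  obtain ⟨z, hz0, hz⟩ := hsval
  obtain ⟨π, hπ0, hπ⟩ := hwsurj
  have hzK : algebraMap F K z ≠ 0 := (map_ne_zero _).2 hz0
  -- `t` has valuation `p * e1s - s`, and `Δ` acts on it through `ω` to first order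
  set t : K := (ζ - 1) ^ p * (algebraMap F K z)⁻¹ with ht_def
  have ht0 : t ≠ 0 := mul_ne_zero (pow_ne_zero _ hζ0) (inv_ne_zero hzK)
  have hwt : w t = ((p * e1s : ℕ) : ℤ) - s := by
    rw [hw.map_mul _ _ (pow_ne_zero _ hζ0) (inv_ne_zero hzK), hw.map_pow hζ0, hw.map_inv hzK, hc,
      hz]
    push_cast
    ring
  have hsum : p * e1s = e * s + e1s := by
    rw [← he1s, Nat.sub_one_mul]
    have := Nat.le_mul_of_pos_left e1s hp.out.pos
    omega
  have ht : 1 ≤ w t := by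
    have := Nat.le_mul_of_pos_left s he
    rw [hwt]
    omega
  have hωinj := hζ.cyclotomicCharacter_injective hKgen hω
  have hcardlt := card_lt_of_injective_units hωinj
  have hcard : (Fintype.card (K ≃ₐ[F] K) : ZMod p) ≠ 0 := fun h =>
    Nat.not_dvd_of_pos_of_lt Fintype.card_pos hcardlt ((ZMod.natCast_eq_zero_iff _ _).1 h)
  have hsp : s < p :=
    (Nat.le_of_dvd Fintype.card_pos (hw.dvd_card_of_isGalois hσ hπ0 hπ hsdvd)).trans_lt hcardlt
  have hpt : ¬ (p : ℤ) ∣ w t := by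
    rw [hwt]
    intro h
    have h1 : (p : ℤ) ∣ s := by
      have := dvd_sub (Int.natCast_dvd_natCast.2 (dvd_mul_right p e1s)) h
      simpa using this
    exact Nat.not_dvd_of_pos_of_lt hs hsp (Int.natCast_dvd_natCast.1 h1)
  have hpow (y : K) (hy0 : y ≠ 0) (hy : ValGE w (w t) (y ^ p - 1)) :
      ValGE w (w t + 1) (y ^ p - 1) := by
    refine hw.pow_sub_one_valGE_succ (c := e1s) ?_ hpK (by omega) hpt ?_ hy0 hy
    · rw [hwp, ← he1s, Nat.cast_mul, Nat.cast_sub hp.out.one_le, Nat.cast_one]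
    · rw [hwt]
      push_cast
      omega
  let m : (K ≃ₐ[F] K) → ℕ := fun σ => (ω σ : ZMod p).val
  have hm (σ : K ≃ₐ[F] K) : (m σ : ZMod p) = ω σ := ZMod.natCast_zmod_val _
  have hm0 (σ : K ≃ₐ[F] K) : (m σ : ZMod p) ≠ 0 := by rw [hm]; exact (ω σ).ne_zero
  have hmul (σ τ : K ≃ₐ[F] K) : (m (σ * τ) : ZMod p) = m σ * m τ := by
    rw [hm, hm, hm, hζ.cyclotomicCharacter_mul hω, Units.val_mul]
  have hσt (σ : K ≃ₐ[F] K) : ValGE w (w t + 1) (σ t - m σ * t) := by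
    obtain ⟨Q, hQ, h⟩ := hw.exists_pow_sub_one_pow_eq hp0 hζ (m σ) hζ1
    have h1 : σ t - m σ * t = (Q - m σ) * t := by
      rw [ht_def, map_mul, map_pow, map_sub, map_one, hω, map_inv₀, AlgEquiv.commutes, h]
      ring
    rw [h1, add_comm]
    exact hw.mul hQ (Or.inr le_rfl)
  obtain ⟨R, P, hR, hP, hRP⟩ := (hw.comap (algebraMap F K)).exists_card_quotient_eq hs hsdvd hz0 hz
    he hew hef
  have hval (i : ℤ) (x : F) :
      ValGE (fun y => w (algebraMap F K y)) i x ↔ ValGE w i (algebraMap F K x) :=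
    or_congr_left (map_eq_zero _).symm
  have hex (a : R) : ∃ x : K, FirstOrder w t x (algebraMap F K a) ∧
      ∀ σ : K ≃ₐ[F] K, ∃ y : K, y ≠ 0 ∧ σ x = x ^ m σ * y ^ p :=
    exists_eigenvector_firstOrder hw hp0 ht hσ hσt hm0 hcard hmul
      ((hval _ _).1 ((hR a).1 a.2)) fun σ => σ.commutes _
  choose g hg hgσ using hex
  have hg0 (a : R) : g a ≠ 0 := (hg a).ne_zero hw ht
  let A := omegaEigenspaceSubgroup p F K ω ⊓ UbarSubgroup p hw ht
  let B := omegaEigenspaceSubgroup p F K ω ⊓ UbarSubgroup p hw (ht.trans (Int.le_add_one le_rfl))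
  have key : Nat.card A = Nat.card (R ⧸ P) * Nat.card B := by
    have hV (a : R) : (QuotientGroup.mk (Units.mk0 (g a) (hg0 a)) : KmodP p K) ∈
        omegaEigenspaceSubgroup p F K ω := mk_mem_omegaEigenspace_iff.2 (hgσ a)
    refine Subgroup.natCard_eq_natCard_quotient_mul P ?_
      (fun a => QuotientGroup.mk (Units.mk0 (g a) (hg0 a))) (fun a => ⟨hV a, ?_⟩) (fun a b => ?_) ?_
    · refine inf_le_inf_left _ ?_
      rintro ⟨x⟩ hx
      obtain ⟨u, y, hy0, hu, h⟩ := mk_mem_UbarSet_iff.1 hx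
      exact mk_mem_UbarSet_iff.2
        ⟨u, y, hy0, IsIntValuation.mono hu (Int.le_add_one le_rfl), h⟩
    · exact mk_mem_UbarSet_iff.2 ⟨g a, 1, one_ne_zero, (hg a).sub_one_valGE hw, by simp⟩
    · rw [hP, hval, AddSubgroupClass.coe_sub, map_sub,
        ← mk_inv_mul_mk_mem_UbarSet_iff hw ht0 ht hpow (x := Units.mk0 (g a) (hg0 a))
          (y := Units.mk0 (g b) (hg0 b)) (hg a) (hg b)]
      exact and_iff_right (Subgroup.mul_mem _ (Subgroup.inv_mem _ (hV a)) (hV b))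
    · rintro ⟨x⟩ ⟨hxV, hxU⟩
      obtain ⟨u, y, hy0, hu, h⟩ := mk_mem_UbarSet_iff.1 hxU
      have hu0 : u ≠ 0 := (hw.eq_zero_of_sub_one (IsIntValuation.mono hu ht)).1
      have hxu : (QuotientGroup.mk x : KmodP p K) = QuotientGroup.mk (Units.mk0 u hu0) :=
        (mk_eq_mk_iff_exists_pow.2 ⟨Units.mk0 y hy0, Units.ext h⟩).symm
      change (QuotientGroup.mk x : KmodP p K) ∈ _ at hxV
      change ∃ a : R, (_)⁻¹ * (QuotientGroup.mk x : KmodP p K) ∈ B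
      rw [hxu] at hxV ⊢
      obtain ⟨a, ha, hua⟩ := exists_fixed_firstOrder hw hp0 ht hσ hσt hm0 hpow hcard hu ht0
        (mk_mem_omegaEigenspace_iff.1 hxV)
      obtain ⟨b, rfl⟩ := (IsGalois.mem_range_algebraMap_iff_fixed a).2 ha
      refine ⟨⟨b, (hR b).2 ((hval _ _).2 hua.1)⟩, Subgroup.mul_mem _ (Subgroup.inv_mem _ (hV _)) hxV, ?_⟩
      refine (mk_inv_mul_mk_mem_UbarSet_iff hw ht0 ht hpow (hg _) hua).2 ?_
      exact Or.inl (sub_self _)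
  rw [← hwt, ← hRP]
  exact key
end

section
/- Let p be a prime number and e ≥ 1 an integer. The set of integers n with 1 ≤ n, n(p−1) < pe and p ∤ n has exactly e elements, and these elements are precisely b^{(1)} < b^{(2)} < ⋯ < b^{(e)}, where b^{(i)} = i + ⌊(i−1)/(p−1)⌋; in particular i ↦ b^{(i)} is strictly increasing on [1, e]. -/
/-- `b^(i) = i + ⌊(i−1)/(p−1)⌋` (with the conventions of natural subtraction/division,
so that `b^(0) = 0`). -/
def bExp (p i : ℕ) : ℕ := i + (i - 1) / (p - 1)

theorem bExp_succ_mul_add {q r : ℕ} (hr : r < q) (a : ℕ) :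
    bExp (q + 1) (q * a + r + 1) = (q + 1) * a + r + 1 := by
  have hdiv : (q * a + r) / q = a := by
    rw [Nat.mul_add_div (by omega), Nat.div_eq_of_lt hr, Nat.add_zero]
  simp only [bExp, Nat.add_sub_cancel, hdiv]
  ring

theorem bExp_strictMono (p : ℕ) : StrictMono (bExp p) := fun _ _ h =>
  Nat.add_lt_add_of_lt_of_le h (Nat.div_le_div_right (by omega))

theorem setOf_not_dvd_eq_image_bExp {q : ℕ} (hq : 0 < q) (e : ℕ) :
    {n : ℕ | 1 ≤ n ∧ n * q < (q + 1) * e ∧ ¬ (q + 1) ∣ n} =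
      bExp (q + 1) '' Set.Icc 1 e := by
  ext n
  constructor
  · rintro ⟨-, hlt, hdvd⟩
    obtain ⟨a, r, hr, rfl⟩ : ∃ a r, r < q ∧ n = (q + 1) * a + r + 1 := by
      have hpos : n % (q + 1) ≠ 0 := fun h => hdvd (Nat.dvd_of_mod_eq_zero h)
      have hmod := Nat.mod_lt n (Nat.add_one_pos q)
      have hn := Nat.div_add_mod n (q + 1)
      exact ⟨n / (q + 1), n % (q + 1) - 1, by omega, by omega⟩
    refine ⟨q * a + r + 1, ⟨by omega, ?_⟩, bExp_succ_mul_add hr a⟩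
    by_contra! h
    nlinarith
  · rintro ⟨i, ⟨hi, hie⟩, rfl⟩
    obtain ⟨a, r, hr, rfl⟩ : ∃ a r, r < q ∧ i = q * a + r + 1 := by
      have hi' := Nat.div_add_mod (i - 1) q
      exact ⟨(i - 1) / q, (i - 1) % q, Nat.mod_lt _ hq, by omega⟩
    rw [bExp_succ_mul_add hr]
    refine ⟨by omega, by nlinarith, fun h => ?_⟩
    rw [Nat.add_assoc, Nat.dvd_add_right (Nat.dvd_mul_right _ _)] at h
    have := Nat.le_of_dvd (by omega) h
    omega

/-- Let `p` be a prime and `e ≥ 1`.  The set of integers `n` with `1 ≤ n`, `n(p−1) < pe`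
and `p ∤ n` has exactly `e` elements, and these elements are precisely
`b^(1) < b^(2) < ⋯ < b^(e)`; in particular `i ↦ b^(i)` is strictly increasing on `[1, e]`. -/
theorem statement9 (p : ℕ) (hp : p.Prime) (e : ℕ) (he : 1 ≤ e) :
    {n : ℕ | 1 ≤ n ∧ n * (p - 1) < p * e ∧ ¬ p ∣ n} = bExp p '' (Set.Icc 1 e) ∧
    StrictMonoOn (bExp p) (Set.Icc 1 e) ∧
    {n : ℕ | 1 ≤ n ∧ n * (p - 1) < p * e ∧ ¬ p ∣ n}.ncard = e := by
  obtain ⟨q, rfl⟩ : ∃ q, p = q + 1 := ⟨p - 1, by have := hp.pos; omega⟩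
  have hq : 0 < q := by have := hp.two_le; omega
  rw [Nat.add_sub_cancel, setOf_not_dvd_eq_image_bExp hq e]
  refine ⟨rfl, (bExp_strictMono _).strictMonoOn _, ?_⟩
  rw [Set.ncard_image_of_injective _ (bExp_strictMono _).injective, ← Finset.coe_Icc,
    Set.ncard_coe_finset, Nat.card_Icc, Nat.add_sub_cancel]
end
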